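/- arXiv:2409.07840 — 4 statements merged into one kernel-verified Lean document; each statement's English description precedes it below -/
import Mathlib

section
/- Let f_1, …, f_z (z ≥ 1) be the LZ-End parsing of a string S and let α be a single character. Then the LZ-End parsing of the string Sα is one of the following three factorizations: (1) f_1, …, f_{z−2}, g where g = f_{z−1} f_z α (this case is possible only if z ≥ 2); (2) f_1, …, f_{z−1}, g where g = f_z α; or (3) f_1, …, f_z, g where g = α. -/
/-- `IsLZEnd S fs` states that `fs = [f₁, …, f_z]` is the (greedy) LZ-End parsing of `S`:
the phrases concatenate to `S`; each phrase is nonempty; for each phrase `f_i`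
(0-based index `k`, so `i = k+1`) starting at position `b = |f₁⋯f_k|`, the phrase without its
last character is a suffix of `f₁⋯f_p` for some `p < i` (i.e. `p ≤ k` with `f₁⋯f₀ = ε`);
and its copyable part has maximal length: any `ℓ` with `b + ℓ + 1 ≤ |S|` such that
`S[b..b+ℓ-1]` is a suffix of some `f₁⋯f_p` with `p ≤ k` satisfies `ℓ ≤ |f_i| - 1`. -/
def IsLZEnd {α : Type*} (S : List α) (fs : List (List α)) : Prop :=
  fs.flatten = S ∧
  ∀ k, (hk : k < fs.length) →
    1 ≤ fs[k].length ∧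
    (∃ p ≤ k, fs[k].dropLast <:+ (fs.take p).flatten) ∧
    (∀ ℓ, ((fs.take k).flatten).length + ℓ + 1 ≤ S.length →
      (∃ p ≤ k, (S.drop ((fs.take k).flatten).length).take ℓ <:+ (fs.take p).flatten) →
      ℓ + 1 ≤ fs[k].length)

theorem List.flatten_drop_eq_drop_flatten {α : Type*} (L : List (List α)) (k : ℕ) :
    L.flatten.drop (L.take k).flatten.length = (L.drop k).flatten := by
  conv_lhs => rw [← List.take_append_drop k L, List.flatten_append]
  simp

theorem List.flatten_drop_eq_getElem_append {α : Type*} (L : List (List α)) (k : ℕ)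
    (hk : k < L.length) : (L.drop k).flatten = L[k] ++ (L.drop (k + 1)).flatten := by
  rw [List.drop_eq_getElem_cons hk, List.flatten_cons]

theorem List.length_flatten_take_add_drop {α : Type*} (L : List (List α)) (k : ℕ) :
    (L.take k).flatten.length + (L.drop k).flatten.length = L.flatten.length := by
  rw [← List.length_append, ← List.flatten_append, List.take_append_drop]

namespace IsLZEnd

variable {α : Type*} {S : List α} {a : α} {fs gs : List (List α)}

theorem drop_eq (h : IsLZEnd S fs) (k : ℕ) :
    S.drop (fs.take k).flatten.length = (fs.drop k).flatten := by
  rw [← h.1, List.flatten_drop_eq_drop_flatten]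

theorem length_eq (h : IsLZEnd S fs) (k : ℕ) :
    (fs.take k).flatten.length + (fs.drop k).flatten.length = S.length := by
  rw [← h.1, List.length_flatten_take_add_drop]

/-- Greediness of the parsing, stated for the part of the string not yet parsed. -/
theorem lt_length_getElem (h : IsLZEnd S fs) {k : ℕ} (hk : k < fs.length) {l p : ℕ}
    (hl : l < (fs.drop k).flatten.length) (hp : p ≤ k)
    (hs : (fs.drop k).flatten.take l <:+ (fs.take p).flatten) : l < fs[k].length := by
  refine (h.2 k hk).2.2 l ?_ ⟨p, hp, ?_⟩
  · have := h.length_eq k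
    omega
  · rwa [h.drop_eq]

theorem drop_eq_nil (h : IsLZEnd S fs) {k : ℕ} (hk : (fs.drop k).flatten = []) :
    fs.drop k = [] := by
  by_contra hne
  have hlt : k < fs.length := by simpa using hne
  rw [List.flatten_drop_eq_getElem_append _ _ hlt, List.append_eq_nil_iff] at hk
  have := (h.2 k hlt).1
  simp [hk.1] at this

/-- The parsings of `S` and of `S ++ [a]` agree until a phrase of the latter exhausts the string. -/
theorem take_succ_eq_or (hfs : IsLZEnd S fs) (hgs : IsLZEnd (S ++ [a]) gs) {k : ℕ}
    (hk : k < fs.length) (htake : gs.take k = fs.take k) :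
    gs.take (k + 1) = fs.take (k + 1) ∨
      gs = fs.take k ++ [(fs.drop k).flatten ++ [a]] ∧
        ∃ p ≤ k, (fs.drop k).flatten <:+ (fs.take p).flatten := by
  have htake' : ∀ p ≤ k, gs.take p = fs.take p := fun p hp => by
    rw [← min_eq_left hp, ← List.take_take, htake, List.take_take]
  have hrest : (gs.drop k).flatten = (fs.drop k).flatten ++ [a] := by
    rw [← hgs.drop_eq, htake, List.drop_append_of_le_length, hfs.drop_eq]
    have := hfs.length_eq k
    omega
  have hkg : k < gs.length := by
    by_contra hge
    rw [List.drop_eq_nil_of_le (by omega)] at hrest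
    simp at hrest
  have hg := hrest
  have hf := List.flatten_drop_eq_getElem_append fs k hk
  rw [List.flatten_drop_eq_getElem_append gs k hkg] at hg
  have hgl := congrArg List.length hg
  have hfl := congrArg List.length hf
  simp only [List.length_append, List.length_singleton] at hgl hfl
  obtain ⟨hg1, ⟨p, hp, hgp⟩, -⟩ := hgs.2 k hkg
  obtain ⟨hf1, ⟨q, hq, hfq⟩, -⟩ := hfs.2 k hk
  rw [htake' p hp] at hgp
  by_cases hm : (fs.drop k).flatten.length < gs[k].length
  · right
    have hnil : (gs.drop (k + 1)).flatten = [] := List.eq_nil_of_length_eq_zero (by omega)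
    rw [hnil, List.append_nil] at hg
    refine ⟨?_, p, hp, ?_⟩
    · rw [← htake, ← hg]
      conv_lhs => rw [← List.take_append_drop k gs, List.drop_eq_getElem_cons hkg,
        hgs.drop_eq_nil hnil]
    · simpa [hg] using hgp
  · left
    have hgpre : gs[k] = (fs.drop k).flatten.take gs[k].length := by
      have := congrArg (List.take gs[k].length) hg
      rwa [List.take_left, List.take_append_of_le_length (by omega)] at this
    have hfpre : fs[k] = (fs.drop k).flatten.take fs[k].length := by
      rw [hf, List.take_left]
    have h1 : gs[k].length - 1 < fs[k].length := by
      refine hfs.lt_length_getElem hk (by omega) hp ?_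
      rw [List.dropLast_eq_take, hgpre, List.take_take] at hgp
      convert hgp using 2
      rw [← hgpre]
      omega
    have h2 : fs[k].length - 1 < gs[k].length := by
      refine hgs.lt_length_getElem hkg (p := q) (by rw [hrest, List.length_append]; omega) hq ?_
      rw [htake' q hq, hrest, List.take_append_of_le_length (by omega), hf,
        List.take_append_of_le_length (by omega), ← List.dropLast_eq_take]
      exact hfq
    have hlen : gs[k].length = fs[k].length := by omega
    rw [List.take_succ_eq_append_getElem hkg, List.take_succ_eq_append_getElem hk, htake,
      hgpre, hlen, ← hfpre]

/-- If the unparsed part of the string occurs as a suffix of a parsed prefix ending at a phrase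
boundary, then it consists of at most two phrases. -/
theorem length_le_of_drop_isSuffix (h : IsLZEnd S fs) {k p : ℕ} (hk : k < fs.length) (hp : p ≤ k)
    (hs : (fs.drop k).flatten <:+ (fs.take p).flatten) : fs.length ≤ k + 2 := by
  by_contra! hlt
  have hf := List.flatten_drop_eq_getElem_append fs k hk
  have hf' := List.flatten_drop_eq_getElem_append fs (k + 1) (by omega)
  have hf1 := (h.2 k hk).1
  have hf1' := (h.2 (k + 1) (by omega)).1
  obtain _ | p := p
  · have := hs.length_le
    simp [hf] at this
    simp [this.1] at hf1
  have hpl : p < fs.length := by omega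
  have hp1 := (h.2 p hpl).1
  obtain ⟨q, hq, hpq⟩ := (h.2 p hpl).2.1
  have hs2 : (fs.drop (k + 1)).flatten <:+ (fs.take (p + 1)).flatten :=
    (hf ▸ List.suffix_append _ _).trans hs
  rw [List.take_succ_eq_append_getElem hpl, List.flatten_append, List.flatten_singleton] at hs hs2
  by_cases hc : (fs.drop (k + 1)).flatten.length ≤ fs[p].length
  · have hsp : (fs.drop (k + 1)).flatten <:+ fs[p] :=
      List.suffix_of_suffix_length_le hs2 (List.suffix_append _ _) hc
    have hne : (fs.drop (k + 1 + 1)).flatten.length ≠ 0 := fun h0 => by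
      have := h.drop_eq_nil (List.eq_nil_of_length_eq_zero h0)
      rw [List.drop_eq_nil_iff] at this
      omega
    have hl := congrArg List.length hf'
    rw [List.length_append] at hl
    have := h.lt_length_getElem (k := k + 1) (by omega)
      (l := (fs.drop (k + 1)).flatten.length - 1) (p := q) (by omega) (by omega) (by
        rw [← List.dropLast_eq_take]
        refine List.IsSuffix.trans ?_ hpq
        obtain ⟨t, ht⟩ := hsp
        rw [← ht, List.dropLast_append_of_ne_nil (fun h0 => by simp [h0] at hl; omega)]
        exact List.suffix_append _ _)
    omega
  · have hl := congrArg List.length hf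
    rw [List.length_append] at hl
    have := h.lt_length_getElem hk (l := (fs.drop k).flatten.length - fs[p].length) (p := p)
      (by omega) (by omega) (by
        obtain ⟨t, ht⟩ := hs
        have h3 := congrArg List.length ht
        simp only [List.length_append] at h3
        have h4 := congrArg (List.take (fs.take p).flatten.length) ht
        rw [List.take_left, List.take_append, List.take_of_length_le (by omega)] at h4
        refine ⟨t, ?_⟩
        rw [← h4]
        congr 2
        omega)
    omega

end IsLZEnd

/-- Lemma 3 of Kempa & Kosolobov: if `f₁, …, f_z` is the LZ-End parsing of `S`, then the
LZ-End parsing of `Sα` is obtained by (1) merging the last two phrases with `α` appended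
(possible only if `z ≥ 2`), (2) extending the last phrase by `α`, or (3) appending the new
single-character phrase `α`. -/
theorem lzEnd_last_phrase_cases {α : Type*} (S : List α) (a : α)
    (fs gs : List (List α)) (hz : 1 ≤ fs.length)
    (hfs : IsLZEnd S fs) (hgs : IsLZEnd (S ++ [a]) gs) :
    (2 ≤ fs.length ∧
      gs = fs.take (fs.length - 2) ++
        [fs.getD (fs.length - 2) [] ++ fs.getD (fs.length - 1) [] ++ [a]]) ∨
    gs = fs.take (fs.length - 1) ++ [fs.getD (fs.length - 1) [] ++ [a]] ∨
    gs = fs ++ [[a]] := by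
  have key : ∀ k ≤ fs.length, gs.take k = fs.take k ∨
      ∃ j < fs.length, gs = fs.take j ++ [(fs.drop j).flatten ++ [a]] ∧
        ∃ p ≤ j, (fs.drop j).flatten <:+ (fs.take p).flatten := by
    intro k
    induction k with
    | zero => simp
    | succ k ih =>
      intro hk
      rcases ih (by omega) with h | h
      · exact (hfs.take_succ_eq_or hgs hk h).imp_right fun h => ⟨k, hk, h⟩
      · exact Or.inr h
  rcases key fs.length le_rfl with h | ⟨j, hj, hgj, p, hp, hs⟩
  · right; right
    rw [List.take_length] at h
    have hrest := hgs.drop_eq fs.length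
    rw [h, hfs.1, List.drop_left] at hrest
    have hlt : fs.length < gs.length := by
      by_contra hge
      rw [List.drop_eq_nil_of_le (by omega)] at hrest
      simp at hrest
    have h1 := (hgs.2 _ hlt).1
    rw [List.flatten_drop_eq_getElem_append _ _ hlt] at hrest
    have hl := congrArg List.length hrest
    simp only [List.length_append, List.length_singleton] at hl
    have hnil : (gs.drop (fs.length + 1)).flatten = [] :=
      List.eq_nil_of_length_eq_zero (by omega)
    rw [hnil, List.append_nil] at hrest
    conv_lhs => rw [← List.take_append_drop fs.length gs, h, List.drop_eq_getElem_cons hlt,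
      hgs.drop_eq_nil hnil, ← hrest]
  · have hle := hfs.length_le_of_drop_isSuffix hj hp hs
    rw [List.flatten_drop_eq_getElem_append _ _ hj] at hgj
    obtain hz | hz : fs.length = j + 1 ∨ fs.length = j + 2 := by omega
    · right; left
      rw [List.drop_eq_nil_of_le (by omega)] at hgj
      simpa [hz, hj] using hgj
    · left
      have hj' : j + 1 < fs.length := by omega
      rw [List.flatten_drop_eq_getElem_append _ _ hj', List.drop_eq_nil_of_le (by omega)] at hgj
      refine ⟨by omega, ?_⟩
      simpa [hz, hj, hj'] using hgj
end

section
/- Let f_1, …, f_z (z ≥ 1) be the LZ-End parsing of a string S and let α be a single character. Suppose (a) there exists p with 0 ≤ p ≤ z−1 such that the suffix of S of length |f_z| (that is, the string f_z) is a suffix of f_1 ⋯ f_p, and (b) if z ≥ 2, there is no p' with 0 ≤ p' ≤ z−2 such that the string f_{z−1} f_z is a suffix of f_1 ⋯ f_{p'}. Then the LZ-End parsing of Sα is f_1, …, f_{z−1}, g where g = f_z α. -/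
theorem List.drop_length_flatten_take {α : Type*} (fs : List (List α)) {k : ℕ}
    (hk : k < fs.length) :
    fs.flatten.drop (fs.take k).flatten.length = fs[k] ++ (fs.drop (k + 1)).flatten := by
  conv_lhs => rw [← List.take_append_drop k fs]
  rw [List.flatten_append, List.take_append_drop, List.drop_left, List.drop_eq_getElem_cons hk,
    List.flatten_cons]

theorem IsLZEnd.length_getElem_le {α : Type*} {S : List α} {fs gs : List (List α)}
    (hfs : IsLZEnd S fs) (hgs : IsLZEnd S gs) {k : ℕ} (htake : fs.take k = gs.take k)
    (hk : k < fs.length) : ∃ hk' : k < gs.length, fs[k].length ≤ gs[k].length := by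
  obtain ⟨rfl, hf⟩ := hfs
  obtain ⟨hne, ⟨p, hp, hsuf⟩, -⟩ := hf k hk
  have hdrop := List.drop_length_flatten_take fs hk
  have hlen := congrArg List.length hdrop
  rw [List.length_drop, List.length_append] at hlen
  have hk' : k < gs.length := by
    by_contra h
    rw [List.take_of_length_le (l := gs) (by omega)] at htake
    rw [htake, hgs.1] at hlen
    omega
  refine ⟨hk', ?_⟩
  have hmax := (hgs.2 k hk').2.2 (fs[k].length - 1)
  rw [← htake] at hmax
  have := hmax (by omega) ⟨p, hp, by
    rw [hdrop, List.take_append_of_le_length (by omega), ← List.dropLast_eq_take]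
    have htake' : gs.take p = fs.take p := by
      rw [← min_eq_left hp, ← List.take_take, ← List.take_take, htake]
    rwa [htake']⟩
  omega

theorem IsLZEnd.unique {α : Type*} {S : List α} {fs gs : List (List α)}
    (hfs : IsLZEnd S fs) (hgs : IsLZEnd S gs) : fs = gs := by
  have htake : ∀ k, fs.take k = gs.take k := by
    intro k
    induction k with
    | zero => simp
    | succ k ih =>
      by_cases hk : k < fs.length
      · obtain ⟨hk', hle⟩ := hfs.length_getElem_le hgs ih hk
        obtain ⟨_, hge⟩ := hgs.length_getElem_le hfs ih.symm hk'
        have hf := List.drop_length_flatten_take fs hk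
        have hg := List.drop_length_flatten_take gs hk'
        rw [hfs.1] at hf
        rw [hgs.1, ← ih, hf] at hg
        rw [List.take_succ_eq_append_getElem hk, List.take_succ_eq_append_getElem hk', ih,
          (List.append_inj hg (le_antisymm hle hge)).1]
      · have hk' : ¬ k < gs.length := fun h => hk (hgs.length_getElem_le hfs ih.symm h).1
        rw [List.take_of_length_le (by omega), List.take_of_length_le (by omega)] at ih ⊢
        exact ih
  have h := htake (max fs.length gs.length)
  rwa [List.take_of_length_le (by omega), List.take_of_length_le (by omega)] at h

theorem IsLZEnd.extend {α : Type*} {S f : List α} {pre : List (List α)} (a : α)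
    (hfs : IsLZEnd S (pre ++ [f]))
    (hcopy : ∃ p ≤ pre.length, f <:+ (pre.take p).flatten)
    (hnomerge : ∀ k < pre.length, ∀ p ≤ k,
      ¬ (pre.drop k).flatten ++ f <:+ (pre.take p).flatten) :
    IsLZEnd (S ++ [a]) (pre ++ [f ++ [a]]) := by
  obtain ⟨rfl, hf⟩ := hfs
  refine ⟨by simp, fun k hk => ?_⟩
  have htake : ∀ (g : List α) (p : ℕ), p ≤ pre.length →
      (pre ++ [g]).take p = pre.take p := fun g p hp => List.take_append_of_le_length hp
  rw [List.length_append, List.length_singleton] at hk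
  rcases Nat.lt_succ_iff_lt_or_eq.mp hk with hk | rfl
  · obtain ⟨hne, ⟨p, hp, hsuf⟩, hmax⟩ := hf k (by simp; omega)
    rw [List.getElem_append_left hk] at hne hsuf hmax
    simp only [List.getElem_append_left hk]
    rw [htake _ k hk.le] at hmax ⊢
    rw [htake _ p (by omega)] at hsuf
    refine ⟨hne, ⟨p, hp, by rwa [htake _ p (by omega)]⟩, ?_⟩
    rintro ℓ hℓ ⟨q, hq, hqsuf⟩
    rw [htake _ q (by omega)] at hqsuf
    have hsplit : pre.flatten ++ f =
        (pre.take k).flatten ++ ((pre.drop k).flatten ++ f) := by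
      rw [← List.append_assoc, ← List.flatten_append, List.take_append_drop]
    have hS : (pre ++ [f]).flatten = pre.flatten ++ f := by simp
    rw [hS, hsplit] at hmax hqsuf hℓ
    rw [List.append_assoc, List.drop_left] at hqsuf
    rw [List.drop_left] at hmax
    simp only [List.length_append, List.length_singleton] at hℓ hmax
    have hne_len : ℓ ≠ ((pre.drop k).flatten ++ f).length := by
      rintro rfl
      rw [List.take_left] at hqsuf
      exact hnomerge k hk q hq hqsuf
    rw [List.length_append] at hne_len
    refine hmax ℓ (by omega) ⟨q, hq, ?_⟩
    rw [htake _ q (by omega)]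
    rwa [List.take_append_of_le_length (by rw [List.length_append]; omega)] at hqsuf
  · obtain ⟨p, hp, hsuf⟩ := hcopy
    simp only [List.getElem_concat_length, htake _ _ le_rfl, List.take_length]
    refine ⟨by simp, ⟨p, hp, by simpa [htake _ p hp] using hsuf⟩, fun ℓ hℓ _ => ?_⟩
    simp only [List.flatten_append, List.flatten_singleton, List.length_append,
      List.length_singleton] at hℓ ⊢
    omega

/-- If `f_z` is a suffix of `f₁⋯f_p` for some `p ≤ z-1`, but (when `z ≥ 2`) `f_{z-1} f_z`
is not a suffix of any `f₁⋯f_{p'}` with `p' ≤ z-2`, then the LZ-End parsing of `Sα` is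
`f₁, …, f_{z-1}, f_z α` (the extend case). -/
theorem lzEnd_extend_case {α : Type*} (S : List α) (a : α)
    (fs gs : List (List α)) (hz : 1 ≤ fs.length)
    (hfs : IsLZEnd S fs) (hgs : IsLZEnd (S ++ [a]) gs)
    (hcopy : ∃ p ≤ fs.length - 1,
      fs.getD (fs.length - 1) [] <:+ (fs.take p).flatten)
    (hnomerge : 2 ≤ fs.length → ¬ ∃ p ≤ fs.length - 2,
      (fs.getD (fs.length - 2) [] ++ fs.getD (fs.length - 1) []) <:+ (fs.take p).flatten) :
    gs = fs.take (fs.length - 1) ++ [fs.getD (fs.length - 1) [] ++ [a]] := by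
  obtain rfl | ⟨pre, f, rfl⟩ := List.eq_nil_or_concat' fs
  · simp at hz
  have hlast : (pre ++ [f]).getD ((pre ++ [f]).length - 1) [] = f := by simp
  rw [hlast] at hcopy hnomerge ⊢
  simp only [List.length_append, List.length_singleton, Nat.add_sub_cancel] at hcopy hnomerge ⊢
  have htake : ∀ p ≤ pre.length, (pre ++ [f]).take p = pre.take p :=
    fun p hp => List.take_append_of_le_length hp
  rw [List.take_left]
  refine hgs.unique (hfs.extend a ?_ ?_)
  · obtain ⟨p, hp, hsuf⟩ := hcopy
    exact ⟨p, hp, by rwa [htake p hp] at hsuf⟩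
  · intro k hk p hp hsuf
    obtain rfl | ⟨pre', e, rfl⟩ := List.eq_nil_or_concat' pre
    · simp at hk
    rw [List.length_append, List.length_singleton] at hk
    refine hnomerge (by simp) ⟨p, by simp; omega, ?_⟩
    rw [htake p (by simp; omega)]
    refine List.IsSuffix.trans ⟨(pre'.drop k).flatten, ?_⟩ hsuf
    rw [List.drop_append_of_le_length (by omega)]
    simp
end

section
/- Let S be a string of length n ≥ 1 with suffix array A, inverse suffix array A^{-1}, and LCP array H. Then for all positions i ≠ j with A^{-1}[i] < A^{-1}[j], the longest common extension satisfies lce(i, j) = min{ H[x] : A^{-1}[i] + 1 ≤ x ≤ A^{-1}[j] }. -/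
/-- \`lcpLen u v\` is the length of the longest common prefix of \`u\` and \`v\`. -/
def lcpLen {α : Type*} [DecidableEq α] : List α → List α → ℕ
  | a :: u, b :: v => if a = b then lcpLen u v + 1 else 0
  | _, _ => 0

theorem lcpLen_comm {α : Type*} [DecidableEq α] (u v : List α) : lcpLen u v = lcpLen v u := by
  induction u generalizing v with
  | nil => cases v <;> rfl
  | cons a u ih =>
    cases v with
    | nil => rfl
    | cons b v => simp only [lcpLen, ih v, eq_comm (a := a)]

/-- The longest common prefix of the outer two of three lexicographically sorted lists. -/
theorem lcpLen_eq_min_of_lt_of_lt {α : Type*} [LinearOrder α] {u v w : List α}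
    (huv : u < v) (hvw : v < w) : lcpLen u w = min (lcpLen u v) (lcpLen v w) := by
  induction u generalizing v w with
  | nil => simp [lcpLen]
  | cons a u ih =>
    rcases v with _ | ⟨b, v⟩
    · simp at huv
    rcases w with _ | ⟨c, w⟩
    · simp at hvw
    rw [List.cons_lt_cons_iff] at huv hvw
    simp only [lcpLen]
    rcases huv with hab | ⟨rfl, huv⟩
    · have hac : a < c := by
        rcases hvw with hbc | ⟨rfl, -⟩
        · exact hab.trans hbc
        · exact hab
      simp [hab.ne, hac.ne]
    · rcases hvw with hac | ⟨rfl, hvw⟩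
      · simp [hac.ne]
      · simp [ih huv hvw]

/-- In a lexicographically sorted family of lists, the longest common prefix of two members is the
least among those of the consecutive pairs between them. -/
theorem isLeast_lcpLen_of_sorted {α : Type*} [LinearOrder α] {n : ℕ} {f : ℕ → List α} {H : ℕ → ℕ}
    (hf : ∀ r s, r < s → s < n → f r < f s)
    (hH : ∀ r, 0 < r → r < n → H r = lcpLen (f r) (f (r - 1))) {r s : ℕ} (hrs : r + 1 ≤ s)
    (hs : s < n) : IsLeast (H '' Set.Icc (r + 1) s) (lcpLen (f r) (f s)) := by
  induction s, hrs using Nat.le_induction with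
  | base => simp [hH (r + 1) r.succ_pos hs, lcpLen_comm (f r)]
  | succ s hrs ih =>
    have hIcc : Set.Icc (r + 1) (s + 1) = insert (s + 1) (Set.Icc (r + 1) s) := by
      ext x
      simp only [Set.mem_Icc, Set.mem_insert_iff]
      omega
    have hstep : H (s + 1) = lcpLen (f s) (f (s + 1)) := by
      rw [hH (s + 1) s.succ_pos hs, lcpLen_comm, Nat.add_sub_cancel]
    rw [hIcc, Set.image_insert_eq, hstep,
      lcpLen_eq_min_of_lt_of_lt (hf r s hrs (by omega)) (hf s (s + 1) s.lt_succ_self hs), min_comm]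
    exact (ih (by omega)).insert _

/-- Given the suffix array `A` of `S` (a permutation of `{0,…,n-1}` listing the suffixes in
strictly increasing lexicographic order), its inverse `Ainv`, and the LCP array `H`
(`H 0 = 0`, `H r = lce(A r, A (r-1))` for `1 ≤ r < n`), the longest common extension of two
distinct positions `i, j` with `Ainv i < Ainv j` equals
`min { H x : Ainv i + 1 ≤ x ≤ Ainv j }`. -/
theorem lce_eq_min_lcp_range {α : Type*} [LinearOrder α]
    (S : List α) (hn : 1 ≤ S.length) (A Ainv H : ℕ → ℕ)
    (hAmem : ∀ r < S.length, A r < S.length)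
    (hAsorted : ∀ r s, r < s → s < S.length → S.drop (A r) < S.drop (A s))
    (hAinv : ∀ r < S.length, Ainv (A r) = r)
    (hAinv' : ∀ i < S.length, Ainv i < S.length ∧ A (Ainv i) = i)
    (hH0 : H 0 = 0)
    (hH : ∀ r, 0 < r → r < S.length → H r = lcpLen (S.drop (A r)) (S.drop (A (r - 1)))) :
    ∀ i j, i < S.length → j < S.length → i ≠ j → Ainv i < Ainv j →
      lcpLen (S.drop i) (S.drop j) = sInf (H '' Set.Icc (Ainv i + 1) (Ainv j)) := by
  intro i j hi hj _ hij
  have h := isLeast_lcpLen_of_sorted (f := fun r => S.drop (A r)) hAsorted hH hij (hAinv' j hj).1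
  simp only [(hAinv' i hi).2, (hAinv' j hj).2] at h
  exact h.csInf_eq.symm
end

section
/- Let S be a string of length n ≥ 1 with suffix array A. Let X be a nonempty finite subset of {0, …, n−1} (a set of suffix-array ranks) and let r ∈ {0, …, n−1} with r ∉ X. Then the maximum of lce(A[r], A[x]) over x ∈ X is attained at x = max{ x ∈ X : x < r } (the predecessor of r in X) or at x = min{ x ∈ X : x > r } (the successor of r in X), whichever of these exist. -/
theorem cons_le_cons_split {α : Type*} [LinearOrder α] {a b : α} {u v : List α}
    (h : a :: u ≤ b :: v) : a < b ∨ a = b ∧ u ≤ v := by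
  rcases h.lt_or_eq with h | h
  · exact (List.cons_lt_cons_iff.1 h).imp_right fun ⟨e, h⟩ => ⟨e, h.le⟩
  · obtain ⟨rfl, rfl⟩ := List.cons.inj h
    exact Or.inr ⟨rfl, le_rfl⟩

/-- Among strings in increasing order, the common prefix with the first one shrinks. -/
theorem lcpLen_le_left {α : Type*} [LinearOrder α] {u v w : List α} (huv : u < v) (hvw : v ≤ w) :
    lcpLen u w ≤ lcpLen u v := by
  induction u generalizing v w with
  | nil => cases w <;> simp [lcpLen]
  | cons a u ih =>
    rcases v with _ | ⟨b, v⟩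
    · simp at huv
    rcases w with _ | ⟨c, w⟩
    · simp [lcpLen]
    rw [List.cons_lt_cons_iff] at huv
    replace hvw := cons_le_cons_split hvw
    simp only [lcpLen]
    by_cases hac : a = c
    · subst hac
      rcases huv with h | ⟨rfl, h⟩
      · rcases hvw with h' | ⟨rfl, -⟩
        · exact absurd h h'.asymm
        · exact absurd h (lt_irrefl _)
      · rcases hvw with h' | ⟨-, h'⟩
        · exact absurd h' (lt_irrefl _)
        · simpa using ih h h'
    · simp [hac]

/-- Among strings in increasing order, the common prefix with the last one grows. -/
theorem lcpLen_le_right {α : Type*} [LinearOrder α] {u v w : List α} (huv : u ≤ v) (hvw : v < w) :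
    lcpLen w u ≤ lcpLen w v := by
  induction w generalizing u v with
  | nil => simp at hvw
  | cons c w ih =>
    rcases u with _ | ⟨a, u⟩
    · simp [lcpLen]
    rcases v with _ | ⟨b, v⟩
    · exact absurd huv (List.nil_lt_cons a u).not_ge
    replace huv := cons_le_cons_split huv
    rw [List.cons_lt_cons_iff] at hvw
    simp only [lcpLen]
    by_cases hac : c = a
    · subst hac
      rcases hvw with h | ⟨rfl, h⟩
      · rcases huv with h' | ⟨rfl, -⟩
        · exact absurd h h'.asymm
        · exact absurd h (lt_irrefl _)
      · rcases huv with h' | ⟨-, h'⟩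
        · exact absurd h' (lt_irrefl _)
        · simpa using ih h' h
    · simp [hac]

/-- Let `X` be a nonempty finite set of suffix-array ranks and `r ∉ X` a rank. Then the
maximum of `lce(A r, A x)` over `x ∈ X` is attained at the predecessor
`max { x ∈ X : x < r }` or at the successor `min { x ∈ X : x > r }` of `r` in `X`
(whichever of these exist). -/
theorem lce_max_at_pred_or_succ {α : Type*} [LinearOrder α]
    (S : List α) (hn : 1 ≤ S.length) (A : ℕ → ℕ)
    (hAmem : ∀ r < S.length, A r < S.length)
    (hAsorted : ∀ r s, r < s → s < S.length → S.drop (A r) < S.drop (A s))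
    (X : Finset ℕ) (hX : X.Nonempty) (hXmem : ∀ x ∈ X, x < S.length)
    (r : ℕ) (hr : r < S.length) (hrX : r ∉ X) :
    ∃ x₀ ∈ X,
      (∀ x ∈ X, lcpLen (S.drop (A r)) (S.drop (A x)) ≤ lcpLen (S.drop (A r)) (S.drop (A x₀))) ∧
      ((X.filter (fun x => x < r)).max = (x₀ : WithBot ℕ) ∨
       (X.filter (fun x => r < x)).min = (x₀ : WithTop ℕ)) := by
  have mono {s t : ℕ} (hst : s ≤ t) (ht : t < S.length) : S.drop (A s) ≤ S.drop (A t) := by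
    rcases hst.eq_or_lt with rfl | h
    · exact le_rfl
    · exact (hAsorted s t h ht).le
  have below {p : ℕ} (hp : (X.filter (· < r)).max = (p : WithBot ℕ)) :
      p ∈ X ∧ ∀ x ∈ X, x < r →
        lcpLen (S.drop (A r)) (S.drop (A x)) ≤ lcpLen (S.drop (A r)) (S.drop (A p)) := by
    obtain ⟨hpX, hpr⟩ := Finset.mem_filter.1 (Finset.mem_of_max hp)
    exact ⟨hpX, fun x hx hxr => lcpLen_le_right
      (mono (Finset.le_max_of_eq (Finset.mem_filter.2 ⟨hx, hxr⟩) hp) (hXmem p hpX))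
      (hAsorted p r hpr hr)⟩
  have above {q : ℕ} (hq : (X.filter (r < ·)).min = (q : WithTop ℕ)) :
      q ∈ X ∧ ∀ x ∈ X, r < x →
        lcpLen (S.drop (A r)) (S.drop (A x)) ≤ lcpLen (S.drop (A r)) (S.drop (A q)) := by
    obtain ⟨hqX, hrq⟩ := Finset.mem_filter.1 (Finset.mem_of_min hq)
    exact ⟨hqX, fun x hx hrx => lcpLen_le_left (hAsorted r q hrq (hXmem q hqX))
      (mono (Finset.min_le_of_eq (Finset.mem_filter.2 ⟨hx, hrx⟩) hq) (hXmem x hx))⟩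
  obtain ⟨m, hm, hmax⟩ := X.exists_max_image (fun x => lcpLen (S.drop (A r)) (S.drop (A x))) hX
  rcases lt_or_gt_of_ne (ne_of_mem_of_not_mem hm hrX) with h | h
  · obtain ⟨p, hp⟩ := Finset.max_of_mem (Finset.mem_filter (p := (· < r)).2 ⟨hm, h⟩)
    obtain ⟨hpX, hle⟩ := below hp
    exact ⟨p, hpX, fun x hx => (hmax x hx).trans (hle m hm h), Or.inl hp⟩
  · obtain ⟨q, hq⟩ := Finset.min_of_mem (Finset.mem_filter (p := (r < ·)).2 ⟨hm, h⟩)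
    obtain ⟨hqX, hle⟩ := above hq
    exact ⟨q, hqX, fun x hx => (hmax x hx).trans (hle m hm h), Or.inr hq⟩
end
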